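/- In the warden's game with n dice each having m sides (m ≥ 1, n ≥ 1), the goal position, treated as a starting position, has the largest remoteness: for every position x ≠ g, r(x) < r⁺(g). -/

import Mathlib

/-- One move: the rightmost entry is transferred to the far left, becoming `c`,
producing `(c, x₀, …, x_{n−2})`. -/
def shift {α : Type*} {n : ℕ} (c : α) (x : Fin n → α) : Fin n → α :=
  fun i => if _h : (i : ℕ) = 0 then c
    else x ⟨(i : ℕ) - 1, lt_of_le_of_lt (Nat.sub_le _ _) i.isLt⟩

/-- The goal position: every die shows `m - 1`. -/
def goalPos (m n : ℕ) (hm : 1 ≤ m) : Fin n → Fin m :=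
  fun _ => ⟨m - 1, Nat.sub_lt hm Nat.one_pos⟩

/-- `CanWin m n hm hn N x`: the prisoner can force the goal within `N` moves from
position `x`.  It holds iff `x` is the goal, or `N ≥ 1` and both:
(i) for every warden choice `c < x_{n-1}`, `CanWin (N-1)` holds at `(c, x₀, …, x_{n−2})`, and
(ii) there is a prisoner choice `c ≥ x_{n-1}` with `CanWin (N-1)` at `(c, x₀, …, x_{n−2})`. -/
def CanWin (m n : ℕ) (hm : 1 ≤ m) (hn : 1 ≤ n) : ℕ → (Fin n → Fin m) → Prop
  | 0, x => x = goalPos m n hm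
  | N + 1, x => x = goalPos m n hm ∨
      ((∀ c : Fin m, c < x ⟨n - 1, Nat.sub_lt hn Nat.one_pos⟩ →
          CanWin m n hm hn N (shift c x)) ∧
       ∃ c : Fin m, x ⟨n - 1, Nat.sub_lt hn Nat.one_pos⟩ ≤ c ∧
          CanWin m n hm hn N (shift c x))

/-- The remoteness of a position: the least `N` with `CanWin N x`. -/
noncomputable def remoteness (m n : ℕ) (hm : 1 ≤ m) (hn : 1 ≤ n)
    (x : Fin n → Fin m) : ℕ :=
  sInf {N | CanWin m n hm hn N x}

/-- The starting remoteness `r⁺(g)` of the goal position: the least `N ≥ 1` such that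
(i) for every warden choice `c < m − 1`, `CanWin (N−1)` holds at `(c, m−1, …, m−1)`, and
(ii) `CanWin (N−1)` holds at `(m−1, m−1, …, m−1)` (the goal itself, the prisoner's
only choice `c ≥ m−1` being `c = m−1`). -/
noncomputable def startRemoteness (m n : ℕ) (hm : 1 ≤ m) (hn : 1 ≤ n) : ℕ :=
  sInf {N | 1 ≤ N ∧
    (∀ c : Fin m, c < ⟨m - 1, Nat.sub_lt hm Nat.one_pos⟩ →
        CanWin m n hm hn (N - 1) (shift c (goalPos m n hm))) ∧
    CanWin m n hm hn (N - 1) (goalPos m n hm)}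

section WardensGame

variable {m n : ℕ} {hm : 1 ≤ m} {hn : 1 ≤ n}

lemma shift_apply_zero {α : Type*} (c : α) (x : Fin n → α) (h : 0 < n) :
    shift c x ⟨0, h⟩ = c := by
  simp [shift]

lemma shift_apply_succ {α : Type*} (c : α) (x : Fin n → α) {i : ℕ} (h : i + 1 < n) :
    shift c x ⟨i + 1, h⟩ = x ⟨i, Nat.lt_of_succ_lt h⟩ := by
  simp [shift]

lemma le_mk_pred (hm : 1 ≤ m) (c : Fin m) : c ≤ ⟨m - 1, Nat.sub_lt hm Nat.one_pos⟩ :=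
  Fin.mk_le_mk.2 (by omega)

lemma CanWin.succ {N : ℕ} {x : Fin n → Fin m} (h : CanWin m n hm hn N x) :
    CanWin m n hm hn (N + 1) x := by
  induction N generalizing x with
  | zero => exact Or.inl h
  | succ N ih =>
    rcases h with h | ⟨h₁, c, hc, h₂⟩
    · exact Or.inl h
    · exact Or.inr ⟨fun c hc => ih (h₁ c hc), c, hc, ih h₂⟩

lemma CanWin.mono {N K : ℕ} {x : Fin n → Fin m} (h : CanWin m n hm hn N x) (hNK : N ≤ K) :
    CanWin m n hm hn K x := by
  induction hNK with
  | refl => exact h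
  | step _ ih => exact ih.succ

lemma CanWin.goal (N : ℕ) : CanWin m n hm hn N (goalPos m n hm) :=
  CanWin.mono (N := 0) rfl (Nat.zero_le N)

/-- Finitely many winnable positions can be won within a common number of moves. -/
lemma exists_uniform_canWin {p : Fin m → Prop} {f : Fin m → Fin n → Fin m}
    (h : ∀ c, p c → ∃ N, CanWin m n hm hn N (f c)) :
    ∃ N, ∀ c, p c → CanWin m n hm hn N (f c) := by
  classical
  choose! N hN using h
  exact ⟨Finset.univ.sup N, fun c hc => (hN c hc).mono (Finset.le_sup (Finset.mem_univ c))⟩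

lemma exists_canWin_of_shift {x : Fin n → Fin m}
    (h₁ : ∀ c : Fin m, c < x ⟨n - 1, Nat.sub_lt hn Nat.one_pos⟩ →
      ∃ N, CanWin m n hm hn N (shift c x))
    (h₂ : ∃ c : Fin m, x ⟨n - 1, Nat.sub_lt hn Nat.one_pos⟩ ≤ c ∧
      ∃ N, CanWin m n hm hn N (shift c x)) :
    ∃ N, CanWin m n hm hn N x := by
  obtain ⟨N, hN⟩ := exists_uniform_canWin h₁
  obtain ⟨c, hc, K, hK⟩ := h₂
  exact ⟨max N K + 1, Or.inr ⟨fun c hc => (hN c hc).mono (le_max_left _ _),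
    c, hc, hK.mono (le_max_right _ _)⟩⟩

/-- If the prisoner keeps the value of the die for `k` moves, the warden can only decrease the
last `k` entries. -/
lemma exists_canWin_of_keep {k : ℕ} (hk : k ≤ n) {x : Fin n → Fin m}
    (h : ∀ y : Fin n → Fin m,
      (∀ i (hi : i < k), y ⟨i, by omega⟩ ≤ x ⟨n - k + i, by omega⟩) →
      (∀ i (hi : k + i < n), y ⟨k + i, hi⟩ = x ⟨i, by omega⟩) →
      ∃ N, CanWin m n hm hn N y) :
    ∃ N, CanWin m n hm hn N x := by
  induction k generalizing x with
  | zero =>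
    exact h x (fun i hi => absurd hi (Nat.not_lt_zero i)) fun i hi => by simp
  | succ k ih =>
    have keep : ∀ c : Fin m, c ≤ x ⟨n - 1, Nat.sub_lt hn Nat.one_pos⟩ →
        ∃ N, CanWin m n hm hn N (shift c x) := by
      intro c hc
      refine ih (by omega) fun y hy₁ hy₂ => h y (fun i hi => ?_) fun i hi => ?_
      · rcases Nat.lt_succ_iff_lt_or_eq.1 hi with hik | rfl
        · have := hy₁ i hik
          have e : n - k + i = n - (k + 1) + i + 1 := by omega
          simp only [e] at this
          rwa [shift_apply_succ c x (by omega)] at this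
        · have := hy₂ 0 (by omega)
          rw [shift_apply_zero] at this
          have e : n - (i + 1) + i = n - 1 := by omega
          simp only [e]
          exact this.le.trans hc
      · have := hy₂ (i + 1) (by omega)
        rw [shift_apply_succ] at this
        rw [← this]
        congr 2
        omega
    exact exists_canWin_of_shift (fun c hc => keep c hc.le) ⟨_, le_rfl, keep _ le_rfl⟩

lemma toLex_lt_of_le_of_lt {x y : Fin n → Fin m} {i : Fin n} (hle : ∀ j < i, y j ≤ x j)
    (hlt : y i < x i) : toLex y < toLex x := by
  by_contra h
  rcases (not_lt.1 h).eq_or_lt with h | ⟨j, hj, hxy⟩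
  · exact hlt.ne' (congrFun (toLex.injective h) i)
  · rcases lt_trichotomy j i with hji | rfl | hij
    · exact absurd (hle j hji) (not_le.2 hxy)
    · exact lt_asymm hlt hxy
    · exact hlt.ne' (hj i hij)

/-- The prisoner wins from every position, by induction along the lexicographic order. He keeps
raising the die to `m - 1`; as soon as the warden intervenes, keeping the values of the remaining
dice leads to a lexicographically smaller position. -/
lemma exists_canWin (x : Fin n → Fin m) : ∃ N, CanWin m n hm hn N x := by
  suffices H : ∀ z : Lex (Fin n → Fin m), ∃ N, CanWin m n hm hn N (ofLex z) from H (toLex x)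
  intro z
  induction z using WellFoundedLT.induction with
  | ind z ih =>
    obtain ⟨x, rfl⟩ := toLex.surjective z
    let top : Fin m := ⟨m - 1, Nat.sub_lt hm Nat.one_pos⟩
    let raised (i : ℕ) : Fin n → Fin m := fun t => if (t : ℕ) < n - i then top else
      x ⟨t - (n - i), lt_of_le_of_lt (Nat.sub_le _ _) t.isLt⟩
    have raised_win : ∀ i ≤ n, ∃ N, CanWin m n hm hn N (raised i) := by
      intro i
      induction i with
      | zero =>
        refine fun _ => ⟨0, funext fun t => ?_⟩
        simp [raised, top, goalPos]
      | succ i ihi =>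
        intro hi
        have hlast : raised (i + 1) ⟨n - 1, Nat.sub_lt hn Nat.one_pos⟩ = x ⟨i, hi⟩ := by
          simp only [raised]
          rw [if_neg (by omega)]
          congr 2
          omega
        refine exists_canWin_of_shift (fun c hc => ?_) ⟨top, le_mk_pred hm _, ?_⟩
        · rw [hlast] at hc
          refine exists_canWin_of_keep (k := i) (by omega) fun y hy₁ hy₂ => ?_
          refine ih (toLex y) (toLex_lt_of_le_of_lt (i := ⟨i, hi⟩) (fun j hj => ?_) ?_)
          · have := hy₁ j hj
            have hji : (j : ℕ) < i := hj
            have e : n - i + (j : ℕ) = n - (i + 1) + j + 1 := by omega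
            simp only [e] at this
            rw [shift_apply_succ _ _ (by omega)] at this
            simpa [raised] using this
          · have := hy₂ 0 (by omega)
            rw [shift_apply_zero] at this
            exact this.trans_lt hc
        · convert ihi (by omega) using 3
          funext ⟨t, ht⟩
          rcases t with _ | t
          · rw [shift_apply_zero]
            simp only [raised]
            rw [if_pos (by omega)]
          · rw [shift_apply_succ]
            simp only [raised]
            by_cases h : t < n - (i + 1)
            · rw [if_pos h, if_pos (by omega)]
            · rw [if_neg h, if_neg (by omega)]
              congr 2
              omega
    obtain ⟨N, hN⟩ := raised_win n le_rfl
    refine ⟨N, ?_⟩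
    convert hN using 1
    funext t
    simp [raised]

/-- While the oldest die shows `m - 1`, the warden fully controls the next value. -/
lemma CanWin.shift_of_last {N : ℕ} {z : Fin n → Fin m} (h : CanWin m n hm hn N z)
    (hz : z ≠ goalPos m n hm)
    (hlast : z ⟨n - 1, Nat.sub_lt hn Nat.one_pos⟩ = ⟨m - 1, Nat.sub_lt hm Nat.one_pos⟩)
    (d : Fin m) : CanWin m n hm hn (N - 1) (shift d z) := by
  cases N with
  | zero => exact absurd h hz
  | succ N =>
    rcases h with h | ⟨h₁, c, hc, h₂⟩
    · exact absurd h hz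
    · rw [hlast] at h₁ hc
      rcases (le_mk_pred hm d).lt_or_eq with hd | hd
      · exact h₁ d hd
      · rwa [hd, ← le_antisymm (le_mk_pred hm c) hc]

/-- Starting from the goal, the warden can force any position whose last entry different from
`m - 1` is at index `k` after `k + 1` moves. -/
lemma canWin_of_forall_shift_goalPos {N k : ℕ}
    (h : ∀ c : Fin m, c < ⟨m - 1, Nat.sub_lt hm Nat.one_pos⟩ →
      CanWin m n hm hn N (shift c (goalPos m n hm)))
    (hk : k < n) {z : Fin n → Fin m}
    (hzk : z ⟨k, hk⟩ < ⟨m - 1, Nat.sub_lt hm Nat.one_pos⟩)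
    (hz : ∀ j : Fin n, k < j → z j = ⟨m - 1, Nat.sub_lt hm Nat.one_pos⟩) :
    CanWin m n hm hn (N - k) z := by
  induction k generalizing z with
  | zero =>
    rw [Nat.sub_zero]
    convert h _ hzk using 1
    funext ⟨t, ht⟩
    rcases t with _ | t
    · rw [shift_apply_zero]
    · rw [shift_apply_succ]
      exact hz _ (Nat.succ_pos t)
  | succ k ih =>
    let z' : Fin n → Fin m := fun i => if hi : (i : ℕ) + 1 < n then z ⟨i + 1, hi⟩
      else ⟨m - 1, Nat.sub_lt hm Nat.one_pos⟩
    have hz'k : z' ⟨k, by omega⟩ < ⟨m - 1, Nat.sub_lt hm Nat.one_pos⟩ := by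
      simpa [z', hk] using hzk
    have hz' : CanWin m n hm hn (N - k) z' := by
      refine ih (by omega) hz'k fun j hj => ?_
      simp only [z']
      split_ifs with hjn
      · exact hz _ (Nat.succ_lt_succ hj)
      · rfl
    have hne : z' ≠ goalPos m n hm := fun e => hz'k.ne (congrFun e _)
    have hlast : z' ⟨n - 1, Nat.sub_lt hn Nat.one_pos⟩ =
        ⟨m - 1, Nat.sub_lt hm Nat.one_pos⟩ := dif_neg (by simp only; omega)
    rw [← Nat.sub_sub]
    convert hz'.shift_of_last hne hlast (z ⟨0, hn⟩) using 1
    funext ⟨t, ht⟩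
    rcases t with _ | t
    · rw [shift_apply_zero]
    · rw [shift_apply_succ]
      simp [z', ht]

end WardensGame

/-- The goal position, treated as a starting position, has the largest remoteness:
every other position has strictly smaller remoteness. -/
theorem remoteness_lt_startRemoteness (m n : ℕ) (hm : 1 ≤ m) (hn : 1 ≤ n)
    (x : Fin n → Fin m) (hx : x ≠ goalPos m n hm) :
    remoteness m n hm hn x < startRemoteness m n hm hn := by
  have hne : {N | 1 ≤ N ∧
      (∀ c : Fin m, c < ⟨m - 1, Nat.sub_lt hm Nat.one_pos⟩ →
        CanWin m n hm hn (N - 1) (shift c (goalPos m n hm))) ∧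
      CanWin m n hm hn (N - 1) (goalPos m n hm)}.Nonempty := by
    obtain ⟨N, hN⟩ := exists_uniform_canWin (hm := hm) (hn := hn)
      (p := fun c => c < ⟨m - 1, Nat.sub_lt hm Nat.one_pos⟩)
      (f := fun c => shift c (goalPos m n hm)) fun c _ => exists_canWin _
    exact ⟨N + 1, Nat.succ_pos N, hN, CanWin.goal N⟩
  obtain ⟨hpos, hshift, -⟩ : 1 ≤ startRemoteness m n hm hn ∧ _ ∧ _ := Nat.sInf_mem hne
  obtain ⟨i, hi⟩ := Function.ne_iff.1 hx
  obtain ⟨k, hk, hmax⟩ := (Set.toFinite {i | x i ≠ goalPos m n hm i}).exists_maximal ⟨i, hi⟩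
  have hwin := canWin_of_forall_shift_goalPos hshift k.isLt
    ((le_mk_pred hm _).lt_of_ne hk) fun j hj => by
      by_contra hxj
      exact absurd (hmax hxj (le_of_lt hj)) (not_le.2 hj)
  have hle : remoteness m n hm hn x ≤ _ := Nat.sInf_le hwin
  unfold startRemoteness at hpos ⊢
  omega
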